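/- Let {P_{k,m} : 0 ≤ k ≤ m} be an orthonormal basis of 𝒱_m²(W) and set ℚ_m := L_m ℙ_m (regarding the P's as polynomials in (z,z̄) via x = (z+z̄)/2, y = (z−z̄)/(2i)). Then the complex and real reproducing kernels coincide: for all z = x+iy and ζ = u+iv, Σ_{k=0}^{m} Q_{k,m}(z,z̄) conj(Q_{k,m}(ζ,ζ̄)) = Σ_{k=0}^{m} P_{k,m}(x,y) P_{k,m}(u,v); consequently Σ_{m=0}^{n} Σ_{k=0}^{m} Q_{k,m}(z,z̄) conj(Q_{k,m}(ζ,ζ̄)) = Σ_{m=0}^{n} Σ_{k=0}^{m} P_{k,m}(x,y) P_{k,m}(u,v), and in particular these kernels are real valued. -/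

import Mathlib

open MeasureTheory MvPolynomial Matrix Complex
open scoped ComplexOrder

noncomputable section

/-- Evaluation of a polynomial in the two commuting variables `(z, z̄)` at a point `z ∈ ℂ`. -/
def evalz (p : MvPolynomial (Fin 2) ℂ) (z : ℂ) : ℂ :=
  MvPolynomial.eval (fun i : Fin 2 => if i = 0 then z else (starRingEnd ℂ) z) p

/-- The complex inner product `⟨f,g⟩ = ∫_Ω f conj(g) w`. -/
def cip (Ω : Set ℂ) (w : ℂ → ℝ) (p q : MvPolynomial (Fin 2) ℂ) : ℂ :=
  ∫ z in Ω, evalz p z * (starRingEnd ℂ) (evalz q z) * (w z : ℂ)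
/-- Membership in `𝒱_n²(w,ℂ)`: total degree at most `n` and orthogonality to all
polynomials of total degree at most `n-1`. -/
def memV (Ω : Set ℂ) (w : ℂ → ℝ) (n : ℕ) (p : MvPolynomial (Fin 2) ℂ) : Prop :=
  p.totalDegree ≤ n ∧ ∀ q : MvPolynomial (Fin 2) ℂ, q.totalDegree < n → cip Ω w p q = 0
/-- Evaluation of a real polynomial in `(x,y)` at `z = x + iy`. -/
def evalr (p : MvPolynomial (Fin 2) ℝ) (z : ℂ) : ℝ :=
  MvPolynomial.eval (fun i : Fin 2 => if i = 0 then z.re else z.im) p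

/-- The real inner product `⟨f,g⟩_W = ∫_Ω f g W`. -/
def rip (Ω : Set ℂ) (w : ℂ → ℝ) (p q : MvPolynomial (Fin 2) ℝ) : ℝ :=
  ∫ z in Ω, evalr p z * evalr q z * w z

/-- Membership in `𝒱_n²(W)`. -/
def memVR (Ω : Set ℂ) (w : ℂ → ℝ) (n : ℕ) (p : MvPolynomial (Fin 2) ℝ) : Prop :=
  p.totalDegree ≤ n ∧ ∀ q : MvPolynomial (Fin 2) ℝ, q.totalDegree < n → rip Ω w p q = 0

/-- A real polynomial in `(x,y)` regarded as a polynomial in `(z,z̄)` via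
`x = (z+z̄)/2`, `y = (z−z̄)/(2i)`. -/
def toCz (p : MvPolynomial (Fin 2) ℝ) : MvPolynomial (Fin 2) ℂ :=
  MvPolynomial.aeval
    (fun i : Fin 2 => if i = 0 then (C (2⁻¹ : ℂ) * (X 0 + X 1) : MvPolynomial (Fin 2) ℂ)
      else C (-Complex.I / 2) * (X 0 - X 1))
    (MvPolynomial.map (algebraMap ℝ ℂ) p)

/-- The unitary matrix `L_n` relating real and complex orthogonal polynomials. -/
def Lmat (n : ℕ) : Matrix (Fin (n+1)) (Fin (n+1)) ℂ :=
  fun k j =>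
    if 2 * k.1 < n then
      (if j = k then ((Real.sqrt 2 : ℝ)⁻¹ : ℂ) else 0)
        + (if j.1 = n - k.1 then -Complex.I * ((Real.sqrt 2 : ℝ)⁻¹ : ℂ) else 0)
    else if 2 * k.1 = n then (if j = k then 1 else 0)
    else
      (if j.1 = n - k.1 then ((Real.sqrt 2 : ℝ)⁻¹ : ℂ) else 0)
        + (if j = k then Complex.I * ((Real.sqrt 2 : ℝ)⁻¹ : ℂ) else 0)

/-- `ℚ_m = L_m ℙ_m`: the complex polynomial vector obtained from a real one. -/
def LQ (m : ℕ) (P : Fin (m+1) → MvPolynomial (Fin 2) ℝ) :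
    Fin (m+1) → MvPolynomial (Fin 2) ℂ :=
  fun k => ∑ j, Lmat m k j • toCz (P j)

/-- Substituting `x = (z+z̄)/2`, `y = (z−z̄)/(2i)` does not change the values of a polynomial. -/
theorem evalz_toCz (p : MvPolynomial (Fin 2) ℝ) (z : ℂ) : evalz (toCz p) z = (evalr p z : ℂ) := by
  unfold evalz toCz evalr
  induction p using MvPolynomial.induction_on with
  | C a => simp [MvPolynomial.algebraMap_eq]
  | add p q hp hq => simp only [map_add, hp, hq, Complex.ofReal_add]
  | mul_X p i hp =>
    simp only [map_mul, hp, Complex.ofReal_mul]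
    congr 1
    fin_cases i
    · simp [Complex.add_conj]
    · simp only [map_X, aeval_X, eval_X, Fin.mk_one, Fin.isValue, one_ne_zero, if_false,
        map_mul, map_sub, eval_C, if_true, Complex.sub_conj, Complex.ofReal_mul,
        Complex.ofReal_ofNat]
      linear_combination (-(z.im : ℂ)) * Complex.I_mul_I

theorem evalz_LQ (m : ℕ) (P : Fin (m+1) → MvPolynomial (Fin 2) ℝ) (k : Fin (m+1)) (z : ℂ) :
    evalz (LQ m P k) z = ∑ j, Lmat m k j * (evalr (P j) z : ℂ) := by
  simp only [← evalz_toCz]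
  simp [evalz, LQ, MvPolynomial.smul_eval]

theorem Lmat_mulVec (m : ℕ) (a : Fin (m+1) → ℂ) (k : Fin (m+1)) :
    ∑ j, Lmat m k j * a j =
      if 2 * k.1 < m then ((Real.sqrt 2 : ℝ)⁻¹ : ℂ) * (a k - Complex.I * a k.rev)
      else if 2 * k.1 = m then a k
      else ((Real.sqrt 2 : ℝ)⁻¹ : ℂ) * (a k.rev + Complex.I * a k) := by
  have hrev : ∀ j : Fin (m+1), j.1 = m - k.1 ↔ j = k.rev := fun j => by
    rw [Fin.ext_iff, Fin.val_rev]; omega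
  unfold Lmat
  simp only [hrev]
  split_ifs
  · simp only [add_mul, ite_mul, zero_mul, Finset.sum_add_distrib, Finset.sum_ite_eq',
      Finset.mem_univ, if_true]
    ring
  · simp
  · simp only [add_mul, ite_mul, zero_mul, Finset.sum_add_distrib, Finset.sum_ite_eq',
      Finset.mem_univ, if_true]
    ring

theorem Lmat_mulVec_mul_conj (m : ℕ) (a b : Fin (m+1) → ℝ) (k : Fin (m+1)) :
    (∑ j, Lmat m k j * (a j : ℂ)) * (starRingEnd ℂ) (∑ j, Lmat m k j * (b j : ℂ)) =
      2⁻¹ * (a k * b k + a k.rev * b k.rev)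
        + Complex.I / 2 * (a k * b k.rev - a k.rev * b k) := by
  have hs : ((Real.sqrt 2 : ℝ)⁻¹ : ℂ) * ((Real.sqrt 2 : ℝ)⁻¹ : ℂ) = 2⁻¹ := by
    rw [← mul_inv, ← Complex.ofReal_mul, Real.mul_self_sqrt zero_le_two, Complex.ofReal_ofNat]
  rw [Lmat_mulVec m (fun j => (a j : ℂ)), Lmat_mulVec m (fun j => (b j : ℂ))]
  split_ifs with h₁ h₂
  · simp only [map_mul, map_sub, map_inv₀, Complex.conj_ofReal, Complex.conj_I]
    linear_combination (a k - Complex.I * a k.rev) * (b k + Complex.I * b k.rev) * hs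
      - 2⁻¹ * a k.rev * b k.rev * Complex.I_mul_I
  · have hk : k.rev = k := by rw [Fin.ext_iff, Fin.val_rev]; omega
    simp only [hk, Complex.conj_ofReal]
    ring
  · simp only [map_mul, map_add, map_inv₀, Complex.conj_ofReal, Complex.conj_I]
    linear_combination (a k.rev + Complex.I * a k) * (b k.rev - Complex.I * b k) * hs
      - 2⁻¹ * a k * b k * Complex.I_mul_I

/-- `L_m` preserves the Hermitian pairing of real vectors. -/
theorem sum_Lmat_mulVec_mul_conj (m : ℕ) (a b : Fin (m+1) → ℝ) :
    ∑ k, (∑ j, Lmat m k j * (a j : ℂ)) * (starRingEnd ℂ) (∑ j, Lmat m k j * (b j : ℂ)) =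
      ((∑ k, a k * b k : ℝ) : ℂ) := by
  have h₁ : ∑ k : Fin (m+1), (a k.rev * b k.rev : ℂ) = ∑ k, (a k * b k : ℂ) :=
    Equiv.sum_comp Fin.revPerm fun k => (a k * b k : ℂ)
  have h₂ : ∑ k : Fin (m+1), (a k.rev * b k : ℂ) = ∑ k, (a k * b k.rev : ℂ) := by
    simpa using Equiv.sum_comp Fin.revPerm fun k => (a k * b k.rev : ℂ)
  simp only [Lmat_mulVec_mul_conj, Finset.sum_add_distrib, ← Finset.mul_sum,
    Finset.sum_sub_distrib, h₁, h₂]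
  push_cast
  ring

theorem sum_evalz_LQ_mul_conj (m : ℕ) (P : Fin (m+1) → MvPolynomial (Fin 2) ℝ) (z ζ : ℂ) :
    ∑ k, evalz (LQ m P k) z * (starRingEnd ℂ) (evalz (LQ m P k) ζ)
      = ((∑ k, evalr (P k) z * evalr (P k) ζ : ℝ) : ℂ) := by
  simp only [evalz_LQ]
  exact sum_Lmat_mulVec_mul_conj m (fun k => evalr (P k) z) (fun k => evalr (P k) ζ)

/-- If `{P_{k,m}}` is an orthonormal basis of `𝒱_m²(W)` and
`ℚ_m := L_m ℙ_m`, then the complex and real reproducing kernels coincide, for every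
degree `m` and cumulatively; in particular these kernels are real valued. -/
theorem stmt_7 (Ω : Set ℂ) (w : ℂ → ℝ)
    (hw : ∀ z ∈ Ω, 0 ≤ w z)
    (hnorm : (∫ z in Ω, w z) = 1)
    (hIntR : ∀ p q : MvPolynomial (Fin 2) ℝ,
      IntegrableOn (fun z => evalr p z * evalr q z * w z) Ω)
    (hposR : ∀ p : MvPolynomial (Fin 2) ℝ, p ≠ 0 → 0 < rip Ω w p p)
    (P : (m : ℕ) → Fin (m+1) → MvPolynomial (Fin 2) ℝ)
    (hmem : ∀ m k, memVR Ω w m (P m k))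
    (hon : ∀ m (k j : Fin (m+1)), rip Ω w (P m k) (P m j) = if k = j then 1 else 0) :
    (∀ (m : ℕ) (z ζ : ℂ),
      ∑ k, evalz (LQ m (P m) k) z * (starRingEnd ℂ) (evalz (LQ m (P m) k) ζ)
        = ((∑ k, evalr (P m k) z * evalr (P m k) ζ : ℝ) : ℂ)) ∧
    (∀ (n : ℕ) (z ζ : ℂ),
      ∑ m ∈ Finset.range (n+1), ∑ k : Fin (m+1),
          evalz (LQ m (P m) k) z * (starRingEnd ℂ) (evalz (LQ m (P m) k) ζ)
        = ((∑ m ∈ Finset.range (n+1), ∑ k : Fin (m+1),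
            evalr (P m k) z * evalr (P m k) ζ : ℝ) : ℂ)) ∧
    (∀ (n : ℕ) (z ζ : ℂ),
      (∑ m ∈ Finset.range (n+1), ∑ k : Fin (m+1),
          evalz (LQ m (P m) k) z * (starRingEnd ℂ) (evalz (LQ m (P m) k) ζ)).im = 0) := by
  have hsum : ∀ (n : ℕ) (z ζ : ℂ),
      ∑ m ∈ Finset.range (n+1), ∑ k : Fin (m+1),
          evalz (LQ m (P m) k) z * (starRingEnd ℂ) (evalz (LQ m (P m) k) ζ)
        = ((∑ m ∈ Finset.range (n+1), ∑ k : Fin (m+1),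
            evalr (P m k) z * evalr (P m k) ζ : ℝ) : ℂ) := fun n z ζ => by
    simp only [sum_evalz_LQ_mul_conj, Complex.ofReal_sum]
  refine ⟨fun m z ζ => sum_evalz_LQ_mul_conj m (P m) z ζ, hsum, fun n z ζ => ?_⟩
  rw [hsum, Complex.ofReal_im]
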